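/- For every n ≥ 2, the maximal character degree multiplicities of the alternating and symmetric groups satisfy (2/5)·m(S_n) ≤ m(A_n) ≤ (5/2)·m(S_n). -/

import Mathlib

open CategoryTheory Module

/-- Isomorphism-equivalence on irreducible `d`-dimensional complex representations of `G`. -/
def irrSetoid (G : Type) [Group G] (d : ℕ) :
    Setoid {ρ : FDRep ℂ G // Simple ρ ∧ finrank ℂ ρ = d} where
  r x y := Nonempty (x.1 ≅ y.1)
  iseqv := ⟨fun _ => ⟨Iso.refl _⟩, fun ⟨e⟩ => ⟨e.symm⟩, fun ⟨e⟩ ⟨f⟩ => ⟨e.trans f⟩⟩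

/-- The number of irreducible complex characters of `G` of degree `d`, i.e. the number of
isomorphism classes of irreducible `d`-dimensional complex representations of `G`. -/
noncomputable def multOfDegree (G : Type) [Group G] (d : ℕ) : ℕ :=
  Nat.card (Quotient (irrSetoid G d))

/-- `m(G)`: the maximal multiplicity of the irreducible complex character degrees of `G`. -/
noncomputable def maxMult (G : Type) [Group G] : ℕ :=
  sSup (Set.range (multOfDegree G))


namespace Clifford

section Comb

theorem card_le_two_mul {α β : Type*} (A : Set α) (B : Set β) (hB : B.Finite) (hA : A.Finite)
    (f : α → β) (i : α → α) (hf : ∀ a ∈ A, f a ∈ B)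
    (h : ∀ a ∈ A, ∀ b ∈ A, f a = f b → b = a ∨ b = i a) :
    A.ncard ≤ 2 * B.ncard := by
  classical
  lift A to Finset α using hA
  lift B to Finset β using hB
  simp only [Set.ncard_coe_finset, Finset.mem_coe] at *
  refine Finset.card_le_mul_card_image_of_maps_to hf 2 ?_
  intro b _
  by_cases hne : ((A.filter fun a => f a = b)).Nonempty
  · obtain ⟨a, ha⟩ := hne
    rw [Finset.mem_filter] at ha
    refine (Finset.card_le_card (t := {a, i a}) ?_).trans Finset.card_le_two
    intro c hc
    rw [Finset.mem_filter] at hc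
    have := h a ha.1 c hc.1 (ha.2.trans hc.2.symm)
    simpa using this
  · rw [Finset.not_nonempty_iff_eq_empty] at hne
    simp [hne]

theorem two_mul_card_le {α β : Type*} (A : Set α) (B : Set β) (hA : A.Finite)
    (f : α → β) (i : α → α)
    (h : ∀ b ∈ B, ∃ a ∈ A, f a = b ∧ i a ∈ A ∧ i a ≠ a ∧ f (i a) = b) :
    2 * B.ncard ≤ A.ncard := by
  classical
  rcases B.eq_empty_or_nonempty with rfl | ⟨b0, hb0⟩
  · simp
  have : Nonempty α := ⟨(h b0 hb0).choose⟩
  choose! s h1 h2 h3 h4 h5 using h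
  have hB : B.Finite := by
    refine (hA.image f).subset ?_
    intro b hb
    exact ⟨s b, h1 b hb, h2 b hb⟩
  have e1 : (s '' B).ncard = B.ncard := by
    apply Set.InjOn.ncard_image
    intro a ha b hb hab
    rw [← h2 a ha, ← h2 b hb, hab]
  have e2 : ((fun b => i (s b)) '' B).ncard = B.ncard := by
    apply Set.InjOn.ncard_image
    intro a ha b hb hab
    rw [← h5 a ha, ← h5 b hb]
    exact congrArg f hab
  have hd : Disjoint (s '' B) ((fun b => i (s b)) '' B) := by
    rw [Set.disjoint_left]
    rintro _ ⟨b, hb, rfl⟩ ⟨c, hc, hbc⟩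
    have : c = b := by
      rw [← h5 c hc, ← h2 b hb]
      exact congrArg f hbc
    subst this
    exact h4 c hc hbc
  have := Set.ncard_union_eq hd (hB.image _) (hB.image _)
  have hs : s '' B ∪ (fun b => i (s b)) '' B ⊆ A := by
    rintro _ (⟨b, hb, rfl⟩ | ⟨b, hb, rfl⟩)
    · exact h1 b hb
    · exact h3 b hb
  have := Set.ncard_le_ncard hs hA
  omega

end Comb

section Irr

variable {G : Type} [Group G] [Fintype G]

/-- Unnormalised pairing of functions on a finite group. -/
def ip (a b : G → ℂ) : ℂ := ∑ x, a x * b x⁻¹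

/-- The irreducible characters. -/
def Irr (G : Type) [Group G] : Set (G → ℂ) :=
  {χ | ∃ V : FDRep ℂ G, Simple V ∧ V.character = χ}

theorem card_ne : (Nat.card G : ℂ) ≠ 0 := by
  have : 0 < Nat.card G := Nat.card_pos
  exact_mod_cast this.ne'

theorem ip_simple (V W : FDRep ℂ G) [Simple V] [Simple W] [Decidable (Nonempty (V ≅ W))] :
    ip V.character W.character = if Nonempty (V ≅ W) then (Nat.card G : ℂ) else 0 := by
  have := invertibleOfNonzero (card_ne (G := G))
  have h := FDRep.char_orthonormal V W
  rw [inv_mul_eq_iff_eq_mul₀ card_ne] at h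
  unfold ip
  rw [h]
  split_ifs <;> simp

theorem iso_iff (V W : FDRep ℂ G) [Simple V] [Simple W] :
    Nonempty (V ≅ W) ↔ V.character = W.character := by
  classical
  constructor
  · rintro ⟨e⟩
    exact FDRep.char_iso e
  · intro h
    by_contra hc
    have h1 := ip_simple V W
    have h2 := ip_simple W W
    rw [if_neg hc, h] at h1
    rw [h1, if_pos ⟨Iso.refl _⟩] at h2
    exact card_ne h2.symm

theorem ip_self {a : G → ℂ} (ha : a ∈ Irr G) : ip a a = Nat.card G := by
  classical
  obtain ⟨V, hV, rfl⟩ := ha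
  rw [ip_simple V V, if_pos ⟨Iso.refl _⟩]

theorem ip_ne {a b : G → ℂ} (ha : a ∈ Irr G) (hb : b ∈ Irr G) (h : a ≠ b) : ip a b = 0 := by
  classical
  obtain ⟨V, hV, rfl⟩ := ha
  obtain ⟨W, hW, rfl⟩ := hb
  rw [ip_simple V W, if_neg]
  rwa [iso_iff]

theorem mem_Irr {U : Type} [AddCommGroup U] [Module ℂ U] [FiniteDimensional ℂ U]
    (ρ : Representation ℂ G U) (h : ip ρ.character ρ.character = Nat.card G) :
    ρ.character ∈ Irr G := by
  refine ⟨FDRep.of ρ, ?_, rfl⟩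
  rw [FDRep.simple_iff_char_is_norm_one]
  exact h

theorem ip_finrank {U W : Type} [AddCommGroup U] [Module ℂ U] [FiniteDimensional ℂ U]
    [AddCommGroup W] [Module ℂ W] [FiniteDimensional ℂ W]
    (ρ : Representation ℂ G U) (σ : Representation ℂ G W) :
    ip σ.character ρ.character = Nat.card G * finrank ℂ (Representation.IntertwiningMap ρ σ) := by
  have := invertibleOfNonzero (card_ne (G := G))
  rw [← Representation.card_inv_mul_sum_char_mul_char_eq_finrank, mul_inv_cancel_left₀ card_ne, ip]

theorem Irr_finite : (Irr G).Finite := by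
  have : LinearIndependent ℂ (fun x : Irr G => x.1) := by
    rw [linearIndependent_iff']
    intro s c hc i hi
    have h : ip (∑ j ∈ s, c j • j.1) i.1 = 0 := by
      rw [hc]; simp [ip]
    have h2 : ip (∑ j ∈ s, c j • j.1) i.1 = ∑ j ∈ s, c j * ip j.1 i.1 := by
      simp only [ip, Finset.sum_apply, Finset.sum_mul, Finset.mul_sum, Pi.smul_apply, smul_eq_mul]
      rw [Finset.sum_comm]
      simp only [mul_assoc]
    rw [h2, Finset.sum_eq_single i, ip_self i.2] at h
    · exact (mul_eq_zero.1 h).resolve_right card_ne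
    · intro j _ hj
      rw [ip_ne j.2 i.2 (fun h => hj (Subtype.ext h)), mul_zero]
    · intro h'; exact absurd hi h'
  have hfin : Finite (Irr G) := this.finite
  exact Set.toFinite _

/-- The irreducible characters of degree `d`. -/
def IrrD (G : Type) [Group G] (d : ℕ) : Set (G → ℂ) := {χ | χ ∈ Irr G ∧ χ 1 = d}

theorem IrrD_finite (d : ℕ) : (IrrD G d).Finite := Irr_finite.subset fun _ h => h.1

theorem mult_eq (d : ℕ) : multOfDegree G d = (IrrD G d).ncard := by
  unfold multOfDegree
  rw [← Nat.card_coe_set_eq]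
  refine Nat.card_congr (Equiv.ofBijective (Quotient.lift
    (fun x => (⟨x.1.character, ⟨x.1, x.2.1, rfl⟩, by rw [FDRep.char_one, x.2.2]⟩ : IrrD G d)) ?_) ⟨?_, ?_⟩)
  · rintro x y ⟨e⟩
    exact Subtype.ext (FDRep.char_iso e)
  · intro x y
    induction x, y using Quotient.inductionOn₂ with
    | _ x y =>
      intro h
      have h' : x.1.character = y.1.character := congrArg Subtype.val h
      have := x.2.1
      have := y.2.1
      exact Quotient.sound ((iso_iff _ _).2 h')
  · rintro ⟨_, ⟨V, hV, rfl⟩, hd⟩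
    rw [FDRep.char_one] at hd
    exact ⟨Quotient.mk _ ⟨V, hV, by exact_mod_cast hd⟩, rfl⟩

theorem card_le_maxMult (d : ℕ) : (IrrD G d).ncard ≤ maxMult G := by
  rw [← mult_eq]
  refine le_csSup ⟨(Irr G).ncard, ?_⟩ ⟨d, rfl⟩
  rintro _ ⟨e, rfl⟩
  rw [mult_eq]
  exact Set.ncard_le_ncard (fun _ h => h.1) Irr_finite

theorem exists_maxMult : ∃ d, maxMult G = (IrrD G d).ncard := by
  have : maxMult G ∈ Set.range (multOfDegree G) := by
    refine Nat.sSup_mem ⟨_, 0, rfl⟩ ⟨maxMult G, ?_⟩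
    rintro _ ⟨e, rfl⟩
    rw [mult_eq]
    exact card_le_maxMult e
  obtain ⟨d, hd⟩ := this
  exact ⟨d, by rw [← mult_eq, hd]⟩

theorem nontrivial_of_simple (V : FDRep ℂ G) (hV : V.character ∈ Irr G) : Nontrivial V := by
  by_contra hn
  rw [not_nontrivial_iff_subsingleton] at hn
  have h0 : V.character = 0 := by
    ext x
    have : V.ρ x = 0 := Subsingleton.elim _ _
    simp [FDRep.character, this]
  have := ip_self hV
  rw [h0] at this
  simp only [ip, Pi.zero_apply, mul_zero, Finset.sum_const_zero] at this
  exact card_ne this.symm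

/-- Any nonzero representation has an irreducible constituent. -/
theorem exists_constituent {U : Type} [AddCommGroup U] [Module ℂ U] [FiniteDimensional ℂ U]
    [Nontrivial U] (ρ : Representation ℂ G U) :
    ∃ ψ ∈ Irr G, ip ψ ρ.character ≠ 0 := by
  classical
  let P : ℕ → Prop := fun m => ∃ σ : Subrepresentation ρ, σ.toSubmodule ≠ ⊥ ∧ finrank ℂ σ.toSubmodule = m
  have hP : ∃ m, P m := ⟨_, ⊤, by
    show (⊤ : Submodule ℂ U) ≠ ⊥
    exact top_ne_bot, rfl⟩
  obtain ⟨σ, hσ, hm⟩ := Nat.find_spec hP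
  have hmin : ∀ τ : Subrepresentation ρ, τ.toSubmodule ≠ ⊥ → τ.toSubmodule ≤ σ.toSubmodule →
      τ.toSubmodule = σ.toSubmodule := by
    intro τ h1 h2
    apply Submodule.eq_of_le_of_finrank_le h2
    rw [hm]
    exact Nat.find_min' hP ⟨τ, h1, rfl⟩
  have hirr : σ.toRepresentation.IsIrreducible := by
    have : Nontrivial σ.toSubmodule := (Submodule.nontrivial_iff_ne_bot).2 hσ
    refine { exists_pair_ne := ⟨⊥, ⊤, ?_⟩, eq_bot_or_eq_top := ?_ }
    · intro h
      have := congrArg Subrepresentation.toSubmodule h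
      exact bot_ne_top (α := Submodule ℂ σ.toSubmodule) this
    · intro τ
      let τ' : Subrepresentation ρ :=
        { toSubmodule := τ.toSubmodule.map σ.toSubmodule.subtype
          apply_mem_toSubmodule := by
            rintro g _ ⟨v, hv, rfl⟩
            exact ⟨_, τ.apply_mem_toSubmodule g hv, rfl⟩ }
      by_cases h : τ.toSubmodule = ⊥
      · left
        exact Subrepresentation.toSubmodule_injective h
      · right
        apply Subrepresentation.toSubmodule_injective
        have h1 : τ'.toSubmodule = σ.toSubmodule := by
          apply hmin
          · show τ.toSubmodule.map σ.toSubmodule.subtype ≠ ⊥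
            intro h'
            refine h (Submodule.map_injective_of_injective σ.toSubmodule.injective_subtype ?_)
            rw [h', Submodule.map_bot]
          · exact Submodule.map_subtype_le _ _
        have h2 : τ.toSubmodule.map σ.toSubmodule.subtype = (⊤ : Submodule ℂ σ.toSubmodule).map σ.toSubmodule.subtype := by
          rw [Submodule.map_subtype_top]; exact h1
        exact Submodule.map_injective_of_injective σ.toSubmodule.injective_subtype h2
  have hn : ip σ.toRepresentation.character σ.toRepresentation.character = Nat.card G := by
    rw [ip_finrank, Representation.IsIrreducible.finrank_intertwiningMap_self]; simp
  refine ⟨_, mem_Irr _ hn, ?_⟩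
  have hsymm : ip σ.toRepresentation.character ρ.character
      = ip ρ.character σ.toRepresentation.character := by
    unfold ip
    refine Fintype.sum_equiv (Equiv.inv G) _ _ ?_
    intro x
    simp [mul_comm]
  rw [hsymm, ip_finrank]
  refine mul_ne_zero card_ne ?_
  let inc : Representation.IntertwiningMap σ.toRepresentation ρ :=
    { toLinearMap := σ.toSubmodule.subtype
      isIntertwining' := fun g => by ext; rfl }
  have hinc : inc ≠ 0 := by
    intro h
    apply hσ
    rw [Submodule.eq_bot_iff]
    intro v hv
    exact congrArg (fun f => f ⟨v, hv⟩) h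
  have : Module.Finite ℂ (Representation.IntertwiningMap σ.toRepresentation ρ) := by
    infer_instance
  have : 0 < finrank ℂ (Representation.IntertwiningMap σ.toRepresentation ρ) := 
    Module.finrank_pos_iff_exists_ne_zero.2 ⟨inc, hinc⟩
  exact_mod_cast this.ne'

end Irr

/-- Data of an index two subgroup with a complementing involution. -/
structure Idx2 (G : Type) [Group G] (H : Subgroup G) where
  /-- the sign character -/
  ε : G →* ℤˣ
  /-- the involution -/
  t : G
  mem : ∀ x, x ∈ H ↔ ε x = 1
  εt : ε t = -1
  tt : t * t = 1

section Index2

set_option linter.unusedSectionVars false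

variable {G : Type} [Group G] {H : Subgroup G} (D : Idx2 G H)

namespace Idx2

theorem eps_not {x : G} (h : x ∉ H) : D.ε x = -1 := by
  rw [D.mem] at h
  exact (Int.units_eq_one_or _).resolve_left h

theorem not_mem_iff {x : G} : x ∉ H ↔ D.ε x = -1 := by
  refine ⟨D.eps_not, fun h h' => ?_⟩
  rw [D.mem, h] at h'
  exact absurd h' (by decide)

theorem mul_t_mem {x : G} (h : x ∉ H) : x * D.t ∈ H := by
  rw [D.mem, map_mul, D.eps_not h, D.εt]; decide

theorem mul_t_not_mem {x : G} (h : x ∈ H) : x * D.t ∉ H := by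
  rw [D.mem] at h
  rw [D.not_mem_iff, map_mul, h, D.εt]; decide

theorem mul_t_t (x : G) : x * D.t * D.t = x := by
  rw [mul_assoc, D.tt, mul_one]

theorem t_inv : D.t⁻¹ = D.t := inv_eq_of_mul_eq_one_left D.tt

theorem conj_mem {x : G} (h : x ∈ H) : D.t * x * D.t ∈ H := by
  rw [D.mem] at *
  rw [map_mul, map_mul, h, D.εt]; decide

/-- Conjugation by the involution. -/
def c : H →* H where
  toFun h := ⟨D.t * h * D.t, D.conj_mem h.2⟩
  map_one' := by ext; simp [D.tt]
  map_mul' x y := by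
    ext
    simp only [Subgroup.coe_mul]
    rw [show D.t * ↑x * D.t * (D.t * ↑y * D.t) = D.t * ↑x * (D.t * D.t) * ↑y * D.t by group, D.tt]
    group

@[simp] theorem coe_c (h : H) : (D.c h : G) = D.t * h * D.t := rfl

@[simp] theorem c_c (h : H) : D.c (D.c h) = h := by
  ext
  simp only [coe_c]
  rw [show D.t * (D.t * ↑h * D.t) * D.t = (D.t * D.t) * ↑h * (D.t * D.t) by group, D.tt]
  group

/-- Conjugation as a permutation. -/
def cE : H ≃ H := ⟨D.c, D.c, D.c_c, D.c_c⟩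

/-- twist of a class function -/
def tw (χ : G → ℂ) : G → ℂ := fun x => ((D.ε x : ℤ) : ℂ) * χ x

/-- conjugate of a function -/
def cj (ψ : H → ℂ) : H → ℂ := fun h => ψ (D.c h)

open Classical in
/-- induced function -/
noncomputable def ind (ψ : H → ℂ) : G → ℂ :=
  fun x => if hx : x ∈ H then ψ ⟨x, hx⟩ + ψ (D.c ⟨x, hx⟩) else 0

end Idx2

/-- restriction of a function -/
def res (H : Subgroup G) (χ : G → ℂ) : H → ℂ := fun h => χ h

namespace Idx2

theorem tw_tw (χ : G → ℂ) : D.tw (D.tw χ) = χ := by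
  ext x
  simp only [tw]
  rw [← mul_assoc, ← Int.cast_mul, ← Units.val_mul, Int.units_mul_self]
  simp

theorem cj_cj (ψ : H → ℂ) : D.cj (D.cj ψ) = ψ := by
  ext x; simp [cj]

theorem tw_mem (χ : G → ℂ) {x : G} (h : x ∈ H) : D.tw χ x = χ x := by
  rw [D.mem] at h; simp [tw, h]

theorem tw_not_mem (χ : G → ℂ) {x : G} (h : x ∉ H) : D.tw χ x = - χ x := by
  simp [tw, D.eps_not h]

theorem res_tw (χ : G → ℂ) : res H (D.tw χ) = res H χ := by
  ext x; exact D.tw_mem χ x.2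

theorem ind_cj (ψ : H → ℂ) : D.ind (D.cj ψ) = D.ind ψ := by
  ext x
  unfold ind
  split_ifs
  · simp [cj, add_comm]
  · rfl

theorem tw_ind (ψ : H → ℂ) : D.tw (D.ind ψ) = D.ind ψ := by
  ext x
  by_cases h : x ∈ H
  · rw [D.tw_mem _ h]
  · rw [D.tw_not_mem _ h]; simp [ind, h]

variable [Fintype G] [Fintype H]

theorem sum_split (f : G → ℂ) : ∑ x, f x = ∑ h : H, f h + ∑ h : H, f (h * D.t) := by
  classical
  rw [← Finset.sum_filter_add_sum_filter_not Finset.univ (fun x => x ∈ H) f]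
  congr 1
  · refine (Finset.sum_subtype _ (by simp) f)
  · symm
    refine Finset.sum_bij (fun (h : H) _ => (h : G) * D.t) ?_ ?_ ?_ ?_
    · intro h _; simpa using D.mul_t_not_mem h.2
    · intro a _ b _ hab
      exact Subtype.ext (mul_right_cancel hab)
    · intro x hx
      refine ⟨⟨x * D.t, D.mul_t_mem (by simpa using hx)⟩, Finset.mem_univ _, D.mul_t_t x⟩
    · intros; rfl

theorem card_eq (D : Idx2 G H) : (Nat.card G : ℂ) = 2 * Nat.card H := by
  have := D.sum_split (fun _ => 1)
  simp only [Finset.sum_const, Finset.card_univ, nsmul_eq_mul, mul_one] at this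
  rw [Nat.card_eq_fintype_card, Nat.card_eq_fintype_card, this]
  ring

theorem ip_tw_tw (a b : G → ℂ) : ip (D.tw a) (D.tw b) = ip a b := by
  unfold ip
  refine Finset.sum_congr rfl fun x _ => ?_
  by_cases h : x ∈ H
  · rw [D.tw_mem _ h, D.tw_mem _ (H.inv_mem h)]
  · rw [D.tw_not_mem _ h, D.tw_not_mem _ (fun h' => h (by simpa using h'))]; ring

theorem ip_cj_cj (a b : H → ℂ) : ip (D.cj a) (D.cj b) = ip a b := by
  unfold ip
  refine Fintype.sum_equiv D.cE _ _ fun x => ?_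
  simp [cj, cE]

theorem ip_res (a b : G → ℂ) : 2 * ip (res H a) (res H b) = ip a b + ip a (D.tw b) := by
  unfold ip
  rw [D.sum_split, D.sum_split]
  have h1 : ∀ h : H, a (h * D.t) * D.tw b (h * D.t : G)⁻¹ = - (a (h * D.t) * b (h * D.t : G)⁻¹) := by
    intro h
    rw [D.tw_not_mem]
    · ring
    · intro h'; exact D.mul_t_not_mem h.2 (by simpa using H.inv_mem h')
  have h2 : ∀ h : H, a h * D.tw b (h : G)⁻¹ = a h * b (h : G)⁻¹ := by
    intro h
    rw [D.tw_mem _ (H.inv_mem h.2)]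
  simp only [h1, h2, Finset.sum_neg_distrib]
  simp only [res, Subgroup.coe_inv]
  ring

theorem ind_coe (ψ : H → ℂ) (h : H) : D.ind ψ h = ψ h + D.cj ψ h := by
  simp [ind, cj]

theorem ip_ind (a : H → ℂ) (b : G → ℂ) :
    ip (D.ind a) b = ip a (res H b) + ip (D.cj a) (res H b) := by
  unfold ip
  rw [D.sum_split]
  have h1 : ∀ h : H, D.ind a (h * D.t) = 0 := by
    intro h; simp [ind, D.mul_t_not_mem h.2]
  simp only [h1, zero_mul, Finset.sum_const_zero, add_zero, ind_coe, add_mul,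
    Finset.sum_add_distrib]
  rfl

theorem ip_add (a b c : H → ℂ) : ip a (b + c) = ip a b + ip a c := by
  simp [ip, mul_add, Finset.sum_add_distrib]

theorem res_ind (a : H → ℂ) : res H (D.ind a) = a + D.cj a := by
  ext h; exact D.ind_coe a h

theorem ip_ind_ind (a b : H → ℂ) :
    ip (D.ind a) (D.ind b) = 2 * (ip a b + ip a (D.cj b)) := by
  rw [ip_ind, res_ind, ip_add, ip_add, D.ip_cj_cj]
  have := D.ip_cj_cj a (D.cj b)
  rw [D.cj_cj] at this
  rw [this]; ring

end Idx2

end Index2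

section Reps

set_option linter.unusedSectionVars false

variable {G : Type} [Group G] {H : Subgroup G} (D : Idx2 G H)
variable {U : Type} [AddCommGroup U] [Module ℂ U]

namespace Idx2

/-- twisted representation -/
noncomputable def twRep (ρ : Representation ℂ G U) : Representation ℂ G U where
  toFun x := ((D.ε x : ℤ) : ℂ) • ρ x
  map_one' := by simp
  map_mul' x y := by
    simp only [map_mul, Units.val_mul, Int.cast_mul, smul_mul_smul_comm]

theorem twRep_char (ρ : Representation ℂ G U) : (D.twRep ρ).character = D.tw ρ.character := by
  ext x
  simp [Representation.character, twRep, tw]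

theorem comp_c_char (ρ : Representation ℂ H U) :
    Representation.character (ρ.comp D.c : Representation ℂ H U) = D.cj ρ.character := rfl

open Classical in
/-- Extension of a representation by an intertwining involution. -/
noncomputable def extRep (σ : Representation ℂ H U) (T : U →ₗ[ℂ] U) (hT : T * T = 1)
    (h : ∀ x, T * σ x = σ (D.c x) * T) : Representation ℂ G U where
  toFun x := if hx : x ∈ H then σ ⟨x, hx⟩ else σ ⟨x * D.t, D.mul_t_mem hx⟩ * T
  map_one' := by
    rw [dif_pos H.one_mem]
    exact map_one σ
  map_mul' x y := by
    by_cases hx : x ∈ H <;> by_cases hy : y ∈ H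
    · rw [dif_pos (H.mul_mem hx hy), dif_pos hx, dif_pos hy, ← map_mul]
      rfl
    · have hxy : x * y ∉ H := by
        intro h'
        exact hy (by simpa using H.mul_mem (H.inv_mem hx) h')
      rw [dif_neg hxy, dif_pos hx, dif_neg hy, ← mul_assoc, ← map_mul]
      congr 2
      ext; simp [mul_assoc]
    · have hxy : x * y ∉ H := by
        intro h'
        exact hx (by simpa using H.mul_mem h' (H.inv_mem hy))
      rw [dif_neg hxy, dif_neg hx, dif_pos hy, mul_assoc (σ _) T, h, ← mul_assoc (σ _), ← map_mul]
      congr 2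
      ext
      simp only [Subgroup.coe_mul, coe_c, ← mul_assoc]
      rw [D.mul_t_t]
    · have hxy : x * y ∈ H := by
        rw [D.mem, map_mul, D.eps_not hx, D.eps_not hy]; decide
      rw [dif_pos hxy, dif_neg hx, dif_neg hy, mul_assoc, ← mul_assoc T, h, mul_assoc, hT, mul_one,
        ← map_mul]
      congr 1
      ext
      simp only [Subgroup.coe_mul, coe_c, ← mul_assoc]
      rw [D.mul_t_t, D.mul_t_t]

theorem extRep_mem (σ : Representation ℂ H U) (T : U →ₗ[ℂ] U) (hT : T * T = 1)
    (h : ∀ x, T * σ x = σ (D.c x) * T) {x : G} (hx : x ∈ H) :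
    D.extRep σ T hT h x = σ ⟨x, hx⟩ := dif_pos hx

theorem extRep_not_mem (σ : Representation ℂ H U) (T : U →ₗ[ℂ] U) (hT : T * T = 1)
    (h : ∀ x, T * σ x = σ (D.c x) * T) {x : G} (hx : x ∉ H) :
    D.extRep σ T hT h x = σ ⟨x * D.t, D.mul_t_mem hx⟩ * T := dif_neg hx

/-- The sum of a representation and its conjugate. -/
def sumRep (σ : Representation ℂ H U) : Representation ℂ H (U × U) where
  toFun x := LinearMap.prodMap (σ x) (σ (D.c x))
  map_one' := by ext <;> simp
  map_mul' x y := by ext <;> simp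

/-- The swap. -/
def swp (U : Type) [AddCommGroup U] [Module ℂ U] : (U × U) →ₗ[ℂ] (U × U) :=
  LinearMap.prod (LinearMap.snd ℂ U U) (LinearMap.fst ℂ U U)

/-- The induced representation. -/
noncomputable def indRep (σ : Representation ℂ H U) : Representation ℂ G (U × U) :=
  D.extRep (D.sumRep σ) (swp U) (by ext <;> simp [swp]) (by
    intro x
    ext <;> simp [swp, sumRep])

theorem trace_off [FiniteDimensional ℂ U] (A B : U →ₗ[ℂ] U) :
    LinearMap.trace ℂ (U × U) (LinearMap.prodMap A B * swp U) = 0 := by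
  let N : (U × U) →ₗ[ℂ] (U × U) := LinearMap.prodMap 1 (-1)
  have h1 : N * N = 1 := by ext <;> simp [N]
  have h2 : N * (LinearMap.prodMap A B * swp U) * N = - (LinearMap.prodMap A B * swp U) := by
    ext <;> simp [N, swp]
  have h3 := congrArg (LinearMap.trace ℂ (U × U)) h2
  rw [LinearMap.trace_mul_comm, ← mul_assoc, h1, one_mul, map_neg] at h3
  exact self_eq_neg.1 h3

theorem indRep_char [FiniteDimensional ℂ U] (σ : Representation ℂ H U) :
    (D.indRep σ).character = D.ind σ.character := by
  ext x
  unfold Representation.character ind indRep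
  split_ifs with hx
  · rw [D.extRep_mem _ _ _ _ hx]
    exact LinearMap.trace_prodMap' _ _
  · rw [D.extRep_not_mem _ _ _ _ hx]
    exact trace_off _ _

variable [Fintype G] [Fintype H]

theorem tw_Irr {χ : G → ℂ} (h : χ ∈ Irr G) : D.tw χ ∈ Irr G := by
  have h1 := ip_self h
  obtain ⟨V, hV, rfl⟩ := h
  have := mem_Irr (D.twRep V.ρ)
  rw [D.twRep_char, D.ip_tw_tw] at this
  exact this h1

theorem cj_Irr {ψ : H → ℂ} (h : ψ ∈ Irr H) : D.cj ψ ∈ Irr H := by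
  have h1 := ip_self h
  obtain ⟨V, hV, rfl⟩ := h
  have := mem_Irr (V.ρ.comp D.c : Representation ℂ H V)
  rw [D.comp_c_char, D.ip_cj_cj] at this
  exact this h1

theorem res_Irr {χ : G → ℂ} (h : χ ∈ Irr G) (h' : D.tw χ ≠ χ) : res H χ ∈ Irr H := by
  have h1 := ip_self h
  have h2 := ip_ne h (D.tw_Irr h) h'.symm
  have h3 := D.ip_res χ χ
  rw [h1, h2, add_zero, D.card_eq] at h3
  have h4 := mul_left_cancel₀ two_ne_zero h3
  obtain ⟨V, hV, rfl⟩ := h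
  exact mem_Irr (V.ρ.comp H.subtype : Representation ℂ H V) h4

theorem tw_ne_of_res {χ : G → ℂ} (h : χ ∈ Irr G) (h' : res H χ ∈ Irr H) : D.tw χ ≠ χ := by
  intro h2
  have h3 := D.ip_res χ χ
  rw [h2, ip_self h, ip_self h', D.card_eq] at h3
  have : (Nat.card H : ℂ) = 0 := by linear_combination - h3 / 2
  exact card_ne this

theorem res_inj {χ χ' : G → ℂ} (h : χ ∈ Irr G) (h' : χ' ∈ Irr G) (hr : res H χ = res H χ') :
    χ' = χ ∨ χ' = D.tw χ := by
  by_contra! hc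
  have e1 := D.ip_res χ' χ
  rw [ip_ne h' h hc.1, ip_ne h' (D.tw_Irr h) hc.2, ← hr] at e1
  have e2 := D.ip_res χ χ
  rw [e1, ip_self h] at e2
  by_cases h3 : D.tw χ = χ
  · rw [h3, ip_self h] at e2
    exact card_ne (G := G) (by linear_combination - e2 / 2)
  · rw [ip_ne h (D.tw_Irr h) (Ne.symm h3)] at e2
    exact card_ne (G := G) (by linear_combination - e2)

theorem ind_Irr {ψ : H → ℂ} (h : ψ ∈ Irr H) (h' : D.cj ψ ≠ ψ) : D.ind ψ ∈ Irr G := by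
  have h1 := D.ip_ind_ind ψ ψ
  rw [ip_self h, ip_ne h (D.cj_Irr h) h'.symm, add_zero, ← D.card_eq] at h1
  obtain ⟨V, hV, rfl⟩ := h
  have := mem_Irr (D.indRep V.ρ)
  rw [D.indRep_char] at this
  exact this h1

theorem ind_inj {ψ ψ' : H → ℂ} (h : ψ ∈ Irr H) (h' : ψ' ∈ Irr H) (hr : D.ind ψ = D.ind ψ') :
    ψ' = ψ ∨ ψ' = D.cj ψ := by
  by_contra! hc
  have e1 := D.ip_ind_ind ψ' ψ
  rw [ip_ne h' h hc.1, ip_ne h' (D.cj_Irr h) hc.2, ← hr] at e1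
  have e2 := D.ip_ind_ind ψ ψ
  rw [e1, ip_self h] at e2
  by_cases h3 : D.cj ψ = ψ
  · rw [h3, ip_self h] at e2
    exact card_ne (G := H) (by linear_combination - e2 / 4)
  · rw [ip_ne h (D.cj_Irr h) (Ne.symm h3)] at e2
    exact card_ne (G := H) (by linear_combination - e2 / 2)

theorem exists_ext {ψ : H → ℂ} (h : ψ ∈ Irr H) (h' : D.cj ψ = ψ) :
    ∃ χ ∈ Irr G, res H χ = ψ := by
  have hψ := h
  have hc := D.cj_Irr h
  obtain ⟨V, hV, rfl⟩ := h
  let W : FDRep ℂ H := FDRep.of (V.ρ.comp D.c : Representation ℂ H V)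
  have hWc : W.character = D.cj V.character := rfl
  have hW : Simple W := by
    rw [FDRep.simple_iff_char_is_norm_one, hWc]
    exact ip_self hc
  obtain ⟨e⟩ := (iso_iff V W).2 (by rw [hWc, h'])
  let T0 : V ≃ₗ[ℂ] V := (FDRep.isoToLinearEquiv e : V ≃ₗ[ℂ] W)
  have hT0 : ∀ x, V.ρ (D.c x) = T0.conj (V.ρ x) := fun x => FDRep.Iso.conj_ρ e x
  have hT1 : ∀ x v, T0 (V.ρ x v) = V.ρ (D.c x) (T0 v) := by
    intro x v
    rw [hT0]
    simp [LinearEquiv.conj_apply]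
  have hnt : Nontrivial V := nontrivial_of_simple V hψ
  let ρ : Representation ℂ H V := V.ρ
  have hfr : finrank ℂ (Representation.IntertwiningMap ρ ρ) = 1 := by
    have := ip_finrank ρ ρ
    have h2 : ip ρ.character ρ.character = Nat.card H := ip_self hψ
    rw [h2] at this
    have h3 : ((finrank ℂ (Representation.IntertwiningMap ρ ρ) : ℕ) : ℂ) = 1 :=
      mul_left_cancel₀ (card_ne (G := H)) (by rw [← this, mul_one])
    exact_mod_cast h3
  let I : Representation.IntertwiningMap ρ ρ := ⟨LinearMap.id, fun g => by ext; rfl⟩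
  let J : Representation.IntertwiningMap ρ ρ := ⟨T0.toLinearMap ∘ₗ T0.toLinearMap, fun g => by
    ext v
    show T0 (T0 (V.ρ g v)) = V.ρ g (T0 (T0 v))
    rw [hT1, hT1, D.c_c]⟩
  have hI : I ≠ 0 := by
    intro h0
    obtain ⟨v, hv⟩ := exists_ne (0 : V)
    exact hv (congrArg (fun f => f v) h0)
  obtain ⟨a, ha⟩ := (finrank_eq_one_iff_of_nonzero' I hI).1 hfr J
  have ha' : ∀ v, T0 (T0 v) = a • v := fun v => (congrArg (fun f => f v) ha).symm
  have ha0 : a ≠ 0 := by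
    rintro rfl
    obtain ⟨v, hv⟩ := exists_ne (0 : V)
    have := ha' v
    rw [zero_smul] at this
    exact hv (by simpa using this)
  obtain ⟨s, hs⟩ := IsAlgClosed.exists_pow_nat_eq a (n := 2) (by norm_num)
  have hs0 : s ≠ 0 := by
    rintro rfl; exact ha0 (by rw [← hs]; norm_num)
  let T : V →ₗ[ℂ] V := s⁻¹ • T0.toLinearMap
  have hT : T * T = 1 := by
    ext v
    show s⁻¹ • T0 (s⁻¹ • T0 v) = v
    rw [map_smul, ha', smul_smul, smul_smul, ← hs]
    have : s⁻¹ * (s⁻¹ * s ^ 2) = 1 := by field_simp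
    rw [← mul_assoc] at this
    rw [this, one_smul]
  have hTc : ∀ x, T * ρ x = ρ (D.c x) * T := by
    intro x
    ext v
    show s⁻¹ • T0 (V.ρ x v) = V.ρ (D.c x) (s⁻¹ • T0 v)
    rw [hT1, map_smul]
  have hres : res H (D.extRep ρ T hT hTc).character = V.character := by
    ext x
    show LinearMap.trace ℂ V (D.extRep ρ T hT hTc (x : G)) = _
    rw [D.extRep_mem _ _ _ _ x.2]
    rfl
  refine ⟨_, mem_Irr (D.extRep ρ T hT hTc) ?_, hres⟩
  have e1 := D.ip_res (D.extRep ρ T hT hTc).character (D.extRep ρ T hT hTc).character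
  rw [hres, ip_self hψ, ← D.twRep_char, ← D.card_eq, ip_finrank, ip_finrank] at e1
  rw [ip_finrank]
  set k := finrank ℂ (Representation.IntertwiningMap (D.extRep ρ T hT hTc) (D.extRep ρ T hT hTc))
    with hk
  have hk0 : 0 < k := by
    let I' : Representation.IntertwiningMap (D.extRep ρ T hT hTc) (D.extRep ρ T hT hTc) :=
      ⟨LinearMap.id, fun g => by ext; rfl⟩
    refine Module.finrank_pos_iff_exists_ne_zero.2 ⟨I', ?_⟩
    intro h0
    obtain ⟨v, hv⟩ := exists_ne (0 : V)
    exact hv (congrArg (fun f => f v) h0)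
  rw [← mul_add] at e1
  have e2 := mul_left_cancel₀ (card_ne (G := G)) ((mul_one _).trans e1)
  have e3 : k = 1 := by
    have e4 : 1 = k + finrank ℂ (Representation.IntertwiningMap
      (D.twRep (D.extRep ρ T hT hTc)) (D.extRep ρ T hT hTc)) := by exact_mod_cast e2
    omega
  rw [e3]; simp

theorem exists_ind {χ : G → ℂ} (h : χ ∈ Irr G) (h' : D.tw χ = χ) :
    ∃ ψ ∈ Irr H, D.cj ψ ≠ ψ ∧ D.ind ψ = χ := by
  have hχ := h
  obtain ⟨V, hV, rfl⟩ := h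
  have hnt : Nontrivial V := nontrivial_of_simple V hχ
  obtain ⟨ψ, hψ, hip⟩ := exists_constituent (V.ρ.comp H.subtype : Representation ℂ H V)
  have hr : Representation.character (V.ρ.comp H.subtype : Representation ℂ H V)
    = res H V.character := rfl
  rw [hr] at hip
  have hcj : D.cj (res H V.character) = res H V.character := by
    ext x
    show V.character (D.t * x * D.t) = V.character x
    have := V.char_conj (x : G) D.t
    rwa [D.t_inv] at this
  have hne : D.cj ψ ≠ ψ := by
    intro hc
    obtain ⟨χ', h1, h2⟩ := D.exists_ext hψ hc
    have e1 := D.ip_res χ' V.character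
    rw [h', h2] at e1
    by_cases h3 : χ' = V.character
    · rw [← h3] at h'
      exact D.tw_ne_of_res h1 (h2 ▸ hψ) h'
    · rw [ip_ne h1 hχ h3] at e1
      exact hip (by linear_combination e1 / 2)
  refine ⟨ψ, hψ, hne, ?_⟩
  by_contra hc
  have e1 := D.ip_ind ψ V.character
  have e2 := D.ip_cj_cj ψ (res H V.character)
  rw [hcj] at e2
  rw [ip_ne (D.ind_Irr hψ hne) hχ hc, e2] at e1
  exact hip (by linear_combination - e1 / 2)

theorem ind_one (ψ : H → ℂ) : D.ind ψ 1 = 2 * ψ 1 := by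
  have := D.ind_coe ψ 1
  rw [Subgroup.coe_one] at this
  rw [this, cj, map_one]; ring

theorem deg {ψ : H → ℂ} (h : ψ ∈ Irr H) : ∃ m : ℕ, ψ 1 = m := by
  obtain ⟨V, _, rfl⟩ := h
  exact ⟨_, V.char_one⟩

theorem upper (D : Idx2 G H) (d : ℕ) : 2 * (IrrD H d).ncard ≤ 5 * maxMult G := by
  let E : Set (H → ℂ) := {ψ | ψ ∈ IrrD H d ∧ D.cj ψ = ψ}
  let F : Set (H → ℂ) := {ψ | ψ ∈ IrrD H d ∧ D.cj ψ ≠ ψ}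
  have hEf : E.Finite := (IrrD_finite d).subset fun _ h => h.1
  have hFf : F.Finite := (IrrD_finite d).subset fun _ h => h.1
  have hsub : IrrD H d ⊆ E ∪ F := fun ψ h => by
    by_cases h' : D.cj ψ = ψ
    · exact Or.inl ⟨h, h'⟩
    · exact Or.inr ⟨h, h'⟩
  have h0 := (Set.ncard_le_ncard hsub (hEf.union hFf)).trans (Set.ncard_union_le E F)
  have hE : 2 * E.ncard ≤ (IrrD G d).ncard := by
    refine two_mul_card_le _ _ (IrrD_finite d) (res H) D.tw ?_
    rintro ψ ⟨⟨h1, h2⟩, h3⟩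
    obtain ⟨χ, h4, rfl⟩ := D.exists_ext h1 h3
    refine ⟨χ, ⟨h4, h2⟩, rfl, ⟨D.tw_Irr h4, ?_⟩, D.tw_ne_of_res h4 h1, D.res_tw χ⟩
    rw [D.tw_mem _ H.one_mem]
    exact h2
  have hF : F.ncard ≤ 2 * (IrrD G (2 * d)).ncard := by
    refine card_le_two_mul _ _ (IrrD_finite _) hFf D.ind D.cj ?_ ?_
    · rintro ψ ⟨⟨h1, h2⟩, h3⟩
      refine ⟨D.ind_Irr h1 h3, ?_⟩
      rw [D.ind_one, h2]; push_cast; rfl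
    · rintro a ⟨⟨h1, -⟩, -⟩ b ⟨⟨h2, -⟩, -⟩ hab
      exact D.ind_inj h1 h2 hab
  have := card_le_maxMult (G := G) d
  have := card_le_maxMult (G := G) (2 * d)
  omega

theorem lower (D : Idx2 G H) (d : ℕ) : 2 * (IrrD G d).ncard ≤ 5 * maxMult H := by
  let N : Set (G → ℂ) := {χ | χ ∈ IrrD G d ∧ D.tw χ ≠ χ}
  let C : Set (G → ℂ) := {χ | χ ∈ IrrD G d ∧ D.tw χ = χ}
  have hNf : N.Finite := (IrrD_finite d).subset fun _ h => h.1
  have hCf : C.Finite := (IrrD_finite d).subset fun _ h => h.1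
  have hsub : IrrD G d ⊆ C ∪ N := fun ψ h => by
    by_cases h' : D.tw ψ = ψ
    · exact Or.inl ⟨h, h'⟩
    · exact Or.inr ⟨h, h'⟩
  have h0 := (Set.ncard_le_ncard hsub (hCf.union hNf)).trans (Set.ncard_union_le C N)
  have hN : N.ncard ≤ 2 * (IrrD H d).ncard := by
    refine card_le_two_mul _ _ (IrrD_finite _) hNf (res H) D.tw ?_ ?_
    · rintro χ ⟨⟨h1, h2⟩, h3⟩
      exact ⟨D.res_Irr h1 h3, h2⟩
    · rintro a ⟨⟨h1, -⟩, -⟩ b ⟨⟨h2, -⟩, -⟩ hab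
      exact D.res_inj h1 h2 hab
  have hC : 2 * C.ncard ≤ (IrrD H (d / 2)).ncard := by
    refine two_mul_card_le _ _ (IrrD_finite _) D.ind D.cj ?_
    rintro χ ⟨⟨h1, h2⟩, h3⟩
    obtain ⟨ψ, h4, h5, rfl⟩ := D.exists_ind h1 h3
    obtain ⟨m, hm⟩ := deg h4
    rw [D.ind_one, hm] at h2
    have h6 : 2 * m = d := by exact_mod_cast h2
    have h7 : d / 2 = m := by omega
    rw [h7]
    refine ⟨ψ, ⟨h4, hm⟩, rfl, ⟨D.cj_Irr h4, ?_⟩, h5, D.ind_cj ψ⟩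
    rw [cj, map_one]
    exact hm
  have := card_le_maxMult (G := H) d
  have := card_le_maxMult (G := H) (d / 2)
  omega

end Idx2

end Reps

end Clifford

theorem stmt11 (n : ℕ) (hn : 2 ≤ n) :
    (2 / 5 : ℝ) * (maxMult (Equiv.Perm (Fin n)) : ℝ)
        ≤ (maxMult (alternatingGroup (Fin n)) : ℝ) ∧
    (maxMult (alternatingGroup (Fin n)) : ℝ)
        ≤ (5 / 2 : ℝ) * (maxMult (Equiv.Perm (Fin n)) : ℝ) := by
  let a : Fin n := ⟨0, by omega⟩
  let b : Fin n := ⟨1, by omega⟩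
  have hab : a ≠ b := by simp [a, b]
  let D : Clifford.Idx2 (Equiv.Perm (Fin n)) (alternatingGroup (Fin n)) :=
    { ε := Equiv.Perm.sign
      t := Equiv.swap a b
      mem := fun x => Equiv.Perm.mem_alternatingGroup
      εt := Equiv.Perm.sign_swap hab
      tt := Equiv.swap_mul_self a b }
  obtain ⟨d, hd⟩ := Clifford.exists_maxMult (G := Equiv.Perm (Fin n))
  obtain ⟨e, he⟩ := Clifford.exists_maxMult (G := alternatingGroup (Fin n))
  have h1 := D.lower d
  have h2 := D.upper e
  rw [← hd] at h1
  rw [← he] at h2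
  have h1' : (2 * maxMult (Equiv.Perm (Fin n)) : ℝ) ≤ 5 * maxMult (alternatingGroup (Fin n)) := by
    exact_mod_cast h1
  have h2' : (2 * maxMult (alternatingGroup (Fin n)) : ℝ) ≤ 5 * maxMult (Equiv.Perm (Fin n)) := by
    exact_mod_cast h2
  constructor <;> linarith
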